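/- arXiv:2401.03496 — 2 statements merged into one kernel-verified Lean document; each statement's English description precedes it below -/
import Mathlib

section
/- Let G_n be the n × n Cartesian grid graph. Define x_1 = 1 and x_{i+1} = x_i + Φ_V(G_n, x_i) + 1, and let I be the smallest index with x_I ≥ n². Then CL(G_n) = I; moreover this value is achieved by the greedy strategy that in each round chooses as the next source the smallest uncooled vertex in the simplicial ordering. -/
/-- A cooling sequence for `G`: a sequence `v : Fin k → V` of sources (the `i`-th source,
0-based, is chosen in round `i + 1`) such that each source is uncooled when chosen
(`dist (v i) (v j) > j - i` for `i < j` in 1-based indexing), and the sequence cannot be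
extended: every vertex is cooled by the end of round `k + 1`. -/
def IsCoolingSeq {V : Type*} (G : SimpleGraph V) {k : ℕ} (v : Fin k → V) : Prop :=
  (∀ i j : Fin k, i < j → (j : ℕ) - (i : ℕ) < G.dist (v i) (v j)) ∧
  (∀ u : V, ∃ i : Fin k, (i : ℕ) + 1 + G.dist (v i) u ≤ k + 1)

/-- The round in which the cooling process with sources `v` ends: the maximum over
vertices `u` of the first round in which `u` is cooled, `min_i (i + dist (v i) u)`
(1-based `i`). -/
noncomputable def coolTime {V : Type*} [Fintype V] (G : SimpleGraph V) {k : ℕ}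
    (v : Fin k → V) : ℕ :=
  Finset.univ.sup fun u : V => sInf {m : ℕ | ∃ i : Fin k, m = (i : ℕ) + 1 + G.dist (v i) u}

/-- The cooling number of `G`: the maximum, over all cooling sequences of `G`, of the
round in which the cooling process ends. -/
noncomputable def coolingNumber {V : Type*} [Fintype V] (G : SimpleGraph V) : ℕ :=
  sSup {T : ℕ | ∃ (k : ℕ) (v : Fin k → V), IsCoolingSeq G v ∧ T = coolTime G v}

/-- The node border of `S`: the set of vertices outside `S` adjacent to some vertex
of `S`. -/
def nodeBorder {V : Type*} (G : SimpleGraph V) (S : Set V) : Set V :=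
  {v | v ∉ S ∧ ∃ u ∈ S, G.Adj u v}

/-- The node-isoperimetric parameter of `G` at `s`: the minimum size of the node border
over all vertex sets of cardinality `s`. -/
noncomputable def phiV {V : Type*} [Fintype V] (G : SimpleGraph V) (s : ℕ) : ℕ :=
  sInf {b : ℕ | ∃ S : Set V, S.ncard = s ∧ b = (nodeBorder G S).ncard}

/-- The `n × n` Cartesian grid graph: vertices `(u₁, u₂)` with `(u₁, u₂)` adjacent to
`(v₁, v₂)` iff they agree in one coordinate and differ by one in the other. -/
def gridGraph (n : ℕ) : SimpleGraph (Fin n × Fin n) :=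
  SimpleGraph.fromRel fun u v =>
    (u.1 = v.1 ∧ (u.2 : ℕ) + 1 = (v.2 : ℕ)) ∨ (u.2 = v.2 ∧ (u.1 : ℕ) + 1 = (v.1 : ℕ))

/-- The simplicial ordering on the vertices of the grid: `u < v` iff `u₁ + u₂ < v₁ + v₂`,
or `u₁ + u₂ = v₁ + v₂` and `u₁ < v₁`. -/
def simpLt {n : ℕ} (u v : Fin n × Fin n) : Prop :=
  (u.1 : ℕ) + (u.2 : ℕ) < (v.1 : ℕ) + (v.2 : ℕ) ∨
    ((u.1 : ℕ) + (u.2 : ℕ) = (v.1 : ℕ) + (v.2 : ℕ) ∧ (u.1 : ℕ) < (v.1 : ℕ))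

/-- The sequence `x_1 = 1`, `x_{i+1} = x_i + Φ_V(G_n, x_i) + 1` (0-indexed:
`gridXseq n i` is `x_{i+1}`). -/
noncomputable def gridXseq (n : ℕ) : ℕ → ℕ
  | 0 => 1
  | i + 1 => gridXseq n i + phiV (gridGraph n) (gridXseq n i) + 1


theorem gAdj {n : ℕ} (u v : Fin n × Fin n) : (gridGraph n).Adj u v ↔
    ((u.1 : ℕ) = v.1 ∧ ((u.2 : ℕ) + 1 = v.2 ∨ (v.2 : ℕ) + 1 = u.2)) ∨
    ((u.2 : ℕ) = v.2 ∧ ((u.1 : ℕ) + 1 = v.1 ∨ (v.1 : ℕ) + 1 = u.1)) := by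
  obtain ⟨⟨a, ha⟩, ⟨b, hb⟩⟩ := u
  obtain ⟨⟨c, hc⟩, ⟨d, hd⟩⟩ := v
  simp only [gridGraph, SimpleGraph.fromRel_adj, ne_eq, Prod.mk.injEq, Fin.mk.injEq]
  omega

/-- closed neighbourhood -/
def cnb {V : Type*} (G : SimpleGraph V) (S : Set V) : Set V := S ∪ nodeBorder G S

theorem ncard_cnb {V : Type*} [Finite V] (G : SimpleGraph V) (S : Set V) :
    (cnb G S).ncard = S.ncard + (nodeBorder G S).ncard := by
  refine Set.ncard_union_eq ?_ (Set.toFinite _) (Set.toFinite _)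
  rw [Set.disjoint_left]
  intro a ha hb
  exact hb.1 ha

theorem mem_cnb {V : Type*} (G : SimpleGraph V) (S : Set V) (v : V) :
    v ∈ cnb G S ↔ v ∈ S ∨ ∃ u ∈ S, G.Adj u v := by
  simp only [cnb, nodeBorder, Set.mem_union, Set.mem_ofPred_eq]
  tauto

theorem cnb_mono {V : Type*} (G : SimpleGraph V) {S T : Set V} (h : S ⊆ T) :
    cnb G S ⊆ cnb G T := by
  intro v
  rw [mem_cnb, mem_cnb]
  rintro (h1 | ⟨u, h1, h2⟩)
  · exact Or.inl (h h1)
  · exact Or.inr ⟨u, h h1, h2⟩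

theorem phiV_le {V : Type*} [Fintype V] (G : SimpleGraph V) (S : Set V) :
    phiV G S.ncard ≤ (nodeBorder G S).ncard := Nat.sInf_le ⟨S, rfl, rfl⟩

theorem phiV_mono {V : Type*} [Fintype V] (G : SimpleGraph V) {s : ℕ} (S : Set V)
    (h : s ≤ S.ncard) : s + phiV G s ≤ S.ncard + phiV G S.ncard := by
  have hm : phiV G S.ncard ∈ {b : ℕ | ∃ S' : Set V, S'.ncard = S.ncard ∧
      b = (nodeBorder G S').ncard} := Nat.sInf_mem ⟨_, S, rfl, rfl⟩
  obtain ⟨S', h1, h2⟩ := hm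
  obtain ⟨A, hA, hA2⟩ := Set.exists_subset_card_eq (s := S') (n := s) (by omega)
  have h3 := phiV_le G A
  have h4 := Set.ncard_le_ncard (cnb_mono G hA) (Set.toFinite _)
  rw [ncard_cnb, ncard_cnb] at h4
  rw [hA2] at h3 h4
  omega

theorem disc_ivt (P : ℕ → Prop) (a b : ℕ) (hab : a ≤ b) (ha : P a) (hb : ¬ P b) :
    ∃ c, a ≤ c ∧ c < b ∧ P c ∧ ¬ P (c + 1) := by
  by_contra hc
  push Not at hc
  have : ∀ d, a + d ≤ b → P (a + d) := by
    intro d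
    induction d with
    | zero => intro _; exact ha
    | succ d ih => intro hd; exact hc (a + d) (by omega) (by omega) (ih (by omega))
  apply hb
  have := this (b - a) (by omega)
  rwa [Nat.add_sub_cancel' hab] at this

/-! compression -/
def colOf {n : ℕ} (S : Set (Fin n × Fin n)) (x : Fin n) : Set (Fin n) := {y | (x, y) ∈ S}

def comp {n : ℕ} (S : Set (Fin n × Fin n)) : Set (Fin n × Fin n) :=
  {p | (p.2 : ℕ) < (colOf S p.1).ncard}

theorem ncard_sum_col {n : ℕ} (S : Set (Fin n × Fin n)) :
    S.ncard = ∑ x, (colOf S x).ncard := by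
  classical
  let e : S ≃ Σ x : Fin n, colOf S x :=
    { toFun := fun p => ⟨p.1.1, ⟨p.1.2, p.2⟩⟩
      invFun := fun q => ⟨(q.1, q.2.1), q.2.2⟩
      left_inv := fun p => rfl
      right_inv := fun q => rfl }
  have := Nat.card_congr e
  rw [Nat.card_sigma] at this
  simpa only [Nat.card_coe_set_eq] using this

theorem ncard_col_le {n : ℕ} (A : Set (Fin n)) : A.ncard ≤ n := by
  have := Set.ncard_le_ncard (Set.subset_univ A) (Set.toFinite _)
  simpa [Set.ncard_univ] using this

theorem ncard_lt_fin {n m : ℕ} (h : m ≤ n) : ({y : Fin n | (y : ℕ) < m} : Set (Fin n)).ncard = m := by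
  have h1 : ({y : Fin n | (y : ℕ) < m} : Set (Fin n)) = Set.range (Fin.castLE h) := by
    ext y
    constructor
    · intro hy
      exact ⟨⟨y, hy⟩, rfl⟩
    · rintro ⟨z, rfl⟩
      exact z.2
  rw [h1, ← Set.image_univ, Set.ncard_image_of_injective _ (Fin.castLE_injective h)]
  simp [Set.ncard_univ]

theorem ncard_comp {n : ℕ} (S : Set (Fin n × Fin n)) : (comp S).ncard = S.ncard := by
  rw [ncard_sum_col, ncard_sum_col S]
  refine Finset.sum_congr rfl fun x _ => ?_
  have h : colOf (comp S) x = {y : Fin n | (y : ℕ) < (colOf S x).ncard} := by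
    ext y; exact Iff.rfl
  rw [h]
  exact ncard_lt_fin (ncard_col_le (colOf S x))

theorem fin_border {n : ℕ} (A : Set (Fin n)) (h : A.Nonempty) (h2 : A.ncard < n) :
    ∃ y, y ∉ A ∧ ∃ z ∈ A, ((z : ℕ) + 1 = y ∨ (y : ℕ) + 1 = z) := by
  obtain ⟨a, ha⟩ := h
  have : ∃ b, b ∉ A := by
    by_contra hb
    push Not at hb
    have : A = Set.univ := Set.eq_univ_of_forall hb
    rw [this, Set.ncard_univ] at h2
    simp at h2
  obtain ⟨b, hb⟩ := this
  rcases le_total (a : ℕ) (b : ℕ) with hab | hab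
  · obtain ⟨c, h1, h3, ⟨hc, h4⟩, h5⟩ := disc_ivt (fun i => ∃ h : i < n, (⟨i, h⟩ : Fin n) ∈ A) a b hab
      ⟨a.2, ha⟩ (fun ⟨_, h⟩ => hb h)
    have : c + 1 < n := by have := b.2; omega
    exact ⟨⟨c + 1, this⟩, fun h => h5 ⟨_, h⟩, ⟨c, hc⟩, h4, Or.inl rfl⟩
  · obtain ⟨c, h1, h3, ⟨hc, h4⟩, h5⟩ := disc_ivt (fun i => ∃ h : i < n, (⟨i, h⟩ : Fin n) ∉ A) b a hab
      ⟨b.2, hb⟩ (fun ⟨_, h⟩ => h ha)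
    have : c + 1 < n := by have := a.2; omega
    refine ⟨⟨c, hc⟩, h4, ⟨c + 1, this⟩, ?_, Or.inr rfl⟩
    by_contra h
    exact h5 ⟨_, h⟩

theorem cnb_comp {n : ℕ} (S : Set (Fin n × Fin n)) :
    cnb (gridGraph n) (comp S) ⊆ comp (cnb (gridGraph n) S) := by
  rintro ⟨x, y⟩ h
  have hsub : ∀ x, colOf S x ⊆ colOf (cnb (gridGraph n) S) x := fun x y hy => Or.inl hy
  rw [mem_cnb] at h
  change (y : ℕ) < (colOf (cnb (gridGraph n) S) x).ncard
  rcases h with h | ⟨⟨x', y'⟩, h, hadj⟩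
  · exact lt_of_lt_of_le h (Set.ncard_le_ncard (hsub x) (Set.toFinite _))
  · change (y' : ℕ) < (colOf S x').ncard at h
    rw [gAdj] at hadj
    simp only at hadj
    rcases hadj with ⟨h1, h2⟩ | ⟨h1, h2⟩
    · have h1 := Fin.ext h1
      subst h1
      by_cases hy : (y : ℕ) < (colOf S x').ncard
      · exact lt_of_lt_of_le hy (Set.ncard_le_ncard (hsub _) (Set.toFinite _))
      · have hne : (colOf S x').Nonempty := by
          apply Set.nonempty_of_ncard_ne_zero; omega
        have := y.2
        obtain ⟨z, hz, w, hw, hzw⟩ := fin_border (colOf S x') hne (by omega)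
        have h3 : (colOf S x').ncard < (colOf (cnb (gridGraph n) S) x').ncard := by
          apply Set.ncard_lt_ncard _ (Set.toFinite _)
          refine ⟨hsub _, fun hh => hz (hh ?_)⟩
          change (x', z) ∈ cnb _ S
          rw [mem_cnb]
          refine Or.inr ⟨(x', w), hw, ?_⟩
          rw [gAdj]
          exact Or.inl ⟨rfl, hzw⟩
        omega
    · have h1 := Fin.ext h1
      subst h1
      refine lt_of_lt_of_le h (Set.ncard_le_ncard ?_ (Set.toFinite _))
      intro w hw
      change (x, w) ∈ cnb _ S
      rw [mem_cnb]
      refine Or.inr ⟨(x', w), hw, ?_⟩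
      rw [gAdj]
      exact Or.inr ⟨rfl, h2⟩

def swp {n : ℕ} (S : Set (Fin n × Fin n)) : Set (Fin n × Fin n) := {p | p.swap ∈ S}

theorem ncard_swp {n : ℕ} (S : Set (Fin n × Fin n)) : (swp S).ncard = S.ncard := by
  have : swp S = Prod.swap '' S := by
    rw [Set.image_swap_eq_preimage_swap]; rfl
  rw [this, Set.ncard_image_of_injective _ Prod.swap_injective]

theorem cnb_swp {n : ℕ} (S : Set (Fin n × Fin n)) :
    cnb (gridGraph n) (swp S) = swp (cnb (gridGraph n) S) := by
  have key : ∀ u v : Fin n × Fin n, (gridGraph n).Adj u.swap v.swap ↔ (gridGraph n).Adj u v := by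
    intro u v
    rw [gAdj, gAdj]
    simp only [Prod.fst_swap, Prod.snd_swap]
    tauto
  ext p
  change _ ↔ p.swap ∈ cnb _ S
  rw [mem_cnb, mem_cnb]
  constructor
  · rintro (h | ⟨u, hu, h⟩)
    · exact Or.inl h
    · exact Or.inr ⟨u.swap, hu, (key _ _).2 h⟩
  · rintro (h | ⟨u, hu, h⟩)
    · exact Or.inl h
    · exact Or.inr ⟨u.swap, by simpa [swp] using hu, (key _ _).1 (by simpa using h)⟩

def IsDown {n : ℕ} (S : Set (Fin n × Fin n)) : Prop :=
  ∀ u ∈ S, ∀ v : Fin n × Fin n, (v.1 : ℕ) ≤ u.1 → (v.2 : ℕ) ≤ u.2 → v ∈ S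

theorem exists_down {n : ℕ} (S : Set (Fin n × Fin n)) : ∃ T : Set (Fin n × Fin n),
    IsDown T ∧ T.ncard = S.ncard ∧
      (nodeBorder (gridGraph n) T).ncard ≤ (nodeBorder (gridGraph n) S).ncard := by
  have hc : (swp (comp (swp (comp S)))).ncard = S.ncard := by
    rw [ncard_swp, ncard_comp, ncard_swp, ncard_comp]
  refine ⟨swp (comp (swp (comp S))), ?_, hc, ?_⟩
  · rintro ⟨a, b⟩ hu ⟨c, d⟩ h1 h2
    simp only at h1 h2
    change (a : ℕ) < (colOf (swp (comp S)) b).ncard at hu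
    change (c : ℕ) < (colOf (swp (comp S)) d).ncard
    refine lt_of_le_of_lt h1 (lt_of_lt_of_le hu (Set.ncard_le_ncard ?_ (Set.toFinite _)))
    intro z hz
    change (b : ℕ) < (colOf S z).ncard at hz
    change (d : ℕ) < (colOf S z).ncard
    omega
  · have h1 : (cnb (gridGraph n) (swp (comp (swp (comp S))))).ncard ≤ (cnb (gridGraph n) S).ncard := by
      rw [cnb_swp, ncard_swp]
      refine (Set.ncard_le_ncard (cnb_comp _) (Set.toFinite _)).trans ?_
      rw [ncard_comp, cnb_swp, ncard_swp]
      refine (Set.ncard_le_ncard (cnb_comp _) (Set.toFinite _)).trans ?_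
      rw [ncard_comp]
    rw [ncard_cnb, ncard_cnb] at h1
    omega

/-- level -/
def lev {n : ℕ} (u : Fin n × Fin n) : ℕ := (u.1 : ℕ) + u.2

theorem col_border {n : ℕ} (S : Set (Fin n × Fin n)) (i y z : Fin n) (hyz : (y : ℕ) ≤ z)
    (hy : (i, y) ∈ S) (hz : (i, z) ∉ S) :
    ∃ w : Fin n, (y : ℕ) < w ∧ (w : ℕ) ≤ z ∧ (i, w) ∈ nodeBorder (gridGraph n) S := by
  obtain ⟨c, h1, h3, ⟨hc, h4⟩, h5⟩ := disc_ivt (fun j => ∃ h : j < n, (i, (⟨j, h⟩ : Fin n)) ∈ S) y z hyz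
      ⟨y.2, hy⟩ (fun ⟨_, h⟩ => hz h)
  have : c + 1 < n := by have := z.2; omega
  refine ⟨⟨c + 1, this⟩, by simp; omega, by simp; omega, fun h => h5 ⟨_, h⟩, (i, ⟨c, hc⟩), h4, ?_⟩
  rw [gAdj]
  simp

theorem row_border {n : ℕ} (S : Set (Fin n × Fin n)) (j y z : Fin n) (hyz : (y : ℕ) ≤ z)
    (hy : (y, j) ∈ S) (hz : (z, j) ∉ S) :
    ∃ w : Fin n, (y : ℕ) < w ∧ (w : ℕ) ≤ z ∧ (w, j) ∈ nodeBorder (gridGraph n) S := by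
  obtain ⟨c, h1, h3, ⟨hc, h4⟩, h5⟩ := disc_ivt (fun i => ∃ h : i < n, ((⟨i, h⟩ : Fin n), j) ∈ S) y z hyz
      ⟨y.2, hy⟩ (fun ⟨_, h⟩ => hz h)
  have : c + 1 < n := by have := z.2; omega
  refine ⟨⟨c + 1, this⟩, by simp; omega, by simp; omega, fun h => h5 ⟨_, h⟩, (⟨c, hc⟩, j), h4, ?_⟩
  rw [gAdj]
  simp

/-- counting: border points above/below indexed by a set of columns and a set of rows -/
theorem count_border {n : ℕ} (B : Set (Fin n × Fin n)) (X Y : Finset (Fin n))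
    (P Q : Fin n → Fin n → Prop)
    (hX : ∀ i ∈ X, ∃ w, P i w ∧ (i, w) ∈ B) (hY : ∀ j ∈ Y, ∃ w, Q j w ∧ (w, j) ∈ B)
    (hd : ∀ i ∈ X, ∀ j ∈ Y, P i j → Q j i → False) : X.card + Y.card ≤ B.ncard := by
  classical
  have hn : Nonempty (Fin n) ∨ IsEmpty (Fin n) := (isEmpty_or_nonempty _).symm
  rcases hn with hn | hn
  swap
  · rw [Finset.eq_empty_of_isEmpty X, Finset.eq_empty_of_isEmpty Y]; simp
  choose! f hf using hX
  choose! g hg using hY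
  have h1 : (X.image (fun i => (i, f i))).card = X.card :=
    Finset.card_image_of_injective _ (fun a b h => (Prod.mk.inj h).1)
  have h2 : (Y.image (fun j => (g j, j))).card = Y.card :=
    Finset.card_image_of_injective _ (fun a b h => (Prod.mk.inj h).2)
  rw [← h1, ← h2, ← Finset.card_union_of_disjoint, ← Set.ncard_coe_finset]
  · apply Set.ncard_le_ncard _ (Set.toFinite _)
    intro p hp
    simp only [Finset.coe_union, Finset.coe_image, Set.mem_union, Set.mem_image, Finset.mem_coe] at hp
    rcases hp with ⟨i, hi, rfl⟩ | ⟨j, hj, rfl⟩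
    · exact (hf i hi).2
    · exact (hg j hj).2
  · rw [Finset.disjoint_left]
    intro p hp hq
    simp only [Finset.mem_image] at hp hq
    obtain ⟨i, hi, rfl⟩ := hp
    obtain ⟨j, hj, h⟩ := hq
    obtain ⟨h3, h4⟩ := Prod.mk.inj h
    refine hd i hi j hj ?_ ?_
    · rw [h4]; exact (hf i hi).1
    · rw [← h3]; exact (hg j hj).1

theorem down_cases {n : ℕ} (S : Set (Fin n × Fin n)) (hS : IsDown S) (hne : S.Nonempty) :
    n ≤ (nodeBorder (gridGraph n) S).ncard ∨
    (∃ r, (∀ u ∈ S, lev u ≤ r) ∧ r + 2 ≤ (nodeBorder (gridGraph n) S).ncard) ∨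
    (∃ r, (∀ u, u ∉ S → r ≤ lev u) ∧ r ≤ 2 * n - 2 ∧ 2 * n - 1 - r ≤ (nodeBorder (gridGraph n) S).ncard) ∨
    S = Set.univ := by
  classical
  set B := nodeBorder (gridGraph n) S with hB
  obtain ⟨⟨a0, b0⟩, h0⟩ := hne
  have npos : 0 < n := a0.pos
  by_cases hcol : ∃ i, ∀ y, (i, y) ∈ S
  · obtain ⟨c, hc⟩ := hcol
    by_cases hrow : ∃ j, ∀ x, (x, j) ∈ S
    · obtain ⟨d, hd⟩ := hrow
      by_cases hU : S = Set.univ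
      · right; right; right; exact hU
      right; right; left
      have hU' : (Sᶜ).Nonempty := by
        rw [Set.nonempty_compl]; exact hU
      obtain ⟨⟨x, y⟩, hp, hmin⟩ := Set.exists_min_image Sᶜ lev (Set.toFinite _) hU'
      refine ⟨lev (x, y), fun u hu => hmin u hu, by have := x.2; have := y.2; simp only [lev]; omega, ?_⟩
      have key : ∀ i j : Fin n, x ≤ i → y ≤ j → (i, j) ∉ S := by
        intro i j hi hj h
        exact hp (hS _ h (x, y) hi hj)
      have := count_border B (Finset.Ioi x) (Finset.Ici y) (fun i w => w ≤ y) (fun j w => w ≤ x)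
        (by
          intro i hi
          rw [Finset.mem_Ioi] at hi
          obtain ⟨w, h1, h2, h3⟩ := col_border S i ⟨0, npos⟩ y (Nat.zero_le _)
            (hS _ (hd i) _ le_rfl (Nat.zero_le _)) (key i y hi.le le_rfl)
          exact ⟨w, h2, h3⟩)
        (by
          intro j hj
          rw [Finset.mem_Ici] at hj
          obtain ⟨w, h1, h2, h3⟩ := row_border S j ⟨0, npos⟩ x (Nat.zero_le _)
            (hS _ (hc j) _ (Nat.zero_le _) le_rfl) (key x j le_rfl hj)
          exact ⟨w, h2, h3⟩)
        (by
          intro i hi j hj h1 h2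
          rw [Finset.mem_Ioi] at hi
          exact absurd hi (not_lt.2 h2))
      rw [Fin.card_Ioi, Fin.card_Ici] at this
      have := x.2; have := y.2
      simp only [lev]
      omega
    · push Not at hrow
      left
      have := count_border B ∅ Finset.univ (fun _ _ => False) (fun _ _ => True)
        (by simp)
        (by
          intro j _
          obtain ⟨x, hx⟩ := hrow j
          have hcx : (c : ℕ) ≤ x := by
            by_contra h
            exact hx (hS _ (hc j) (x, j) (by simp; omega) le_rfl)
          obtain ⟨w, h1, h2, h3⟩ := row_border S j c x hcx (hc j) hx
          exact ⟨w, trivial, h3⟩)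
        (by simp)
      simpa using this
  · push Not at hcol
    by_cases hrow : ∃ j, ∀ x, (x, j) ∈ S
    · obtain ⟨d, hd⟩ := hrow
      left
      have := count_border B Finset.univ ∅ (fun _ _ => True) (fun _ _ => False)
        (by
          intro i _
          obtain ⟨y, hy⟩ := hcol i
          have hcx : (d : ℕ) ≤ y := by
            by_contra h
            exact hy (hS _ (hd i) (i, y) le_rfl (by simp; omega))
          obtain ⟨w, h1, h2, h3⟩ := col_border S i d y hcx (hd i) hy
          exact ⟨w, trivial, h3⟩)
        (by simp)
        (by simp)
      simpa using this
    · push Not at hrow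
      right; left
      obtain ⟨⟨x, y⟩, hp, hmax⟩ := Set.exists_max_image S lev (Set.toFinite _) ⟨_, h0⟩
      refine ⟨lev (x, y), fun u hu => hmax u hu, ?_⟩
      have := count_border B (Finset.Iic x) (Finset.Iic y) (fun i w => y < w) (fun j w => x < w)
        (by
          intro i hi
          rw [Finset.mem_Iic] at hi
          have hi2 : (i, y) ∈ S := hS _ hp _ hi le_rfl
          obtain ⟨z, hz⟩ := hcol i
          have hyz : (y : ℕ) ≤ z := by
            by_contra h
            exact hz (hS _ hi2 (i, z) le_rfl (by simp; omega))
          obtain ⟨w, h1, h2, h3⟩ := col_border S i y z hyz hi2 hz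
          exact ⟨w, h1, h3⟩)
        (by
          intro j hj
          rw [Finset.mem_Iic] at hj
          have hi2 : (x, j) ∈ S := hS _ hp _ le_rfl hj
          obtain ⟨z, hz⟩ := hrow j
          have hyz : (x : ℕ) ≤ z := by
            by_contra h
            exact hz (hS _ hi2 (z, j) (by simp; omega) le_rfl)
          obtain ⟨w, h1, h2, h3⟩ := row_border S j x z hyz hi2 hz
          exact ⟨w, h1, h3⟩)
        (by
          intro i hi j hj h1 h2
          rw [Finset.mem_Iic] at hi
          exact absurd h2 (not_lt.2 hi))
      rw [Fin.card_Iic, Fin.card_Iic] at this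
      simp only [lev]
      omega

/-! initial segments -/
def IsInit {n : ℕ} (I : Set (Fin n × Fin n)) : Prop := ∀ u ∈ I, ∀ v, simpLt v u → v ∈ I

theorem simpLt_tri {n : ℕ} (u v : Fin n × Fin n) : simpLt u v ∨ u = v ∨ simpLt v u := by
  obtain ⟨⟨a, ha⟩, ⟨b, hb⟩⟩ := u
  obtain ⟨⟨c, hc⟩, ⟨d, hd⟩⟩ := v
  simp only [simpLt, Prod.mk.injEq, Fin.mk.injEq]
  omega

def skey {n : ℕ} (u : Fin n × Fin n) : ℕ := ((u.1 : ℕ) + u.2) * n + u.1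

theorem simpLt_of_skey {n : ℕ} (u v : Fin n × Fin n) (h : skey u ≤ skey v) :
    u = v ∨ simpLt u v := by
  rcases simpLt_tri u v with h1 | h1 | h1
  · exact Or.inr h1
  · exact Or.inl h1
  · exfalso
    simp only [skey] at h
    have h2 := u.1.2
    have h3 := v.1.2
    rcases h1 with h1 | ⟨h1, h4⟩
    · nlinarith
    · rw [h1] at h; omega

theorem exists_simp_min {n : ℕ} (S : Set (Fin n × Fin n)) (h : S.Nonempty) :
    ∃ p ∈ S, ∀ u ∈ S, p = u ∨ simpLt p u := by
  obtain ⟨p, hp, h1⟩ := Set.exists_min_image S skey (Set.toFinite _) h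
  exact ⟨p, hp, fun u hu => simpLt_of_skey _ _ (h1 u hu)⟩

theorem exists_simp_max {n : ℕ} (S : Set (Fin n × Fin n)) (h : S.Nonempty) :
    ∃ p ∈ S, ∀ u ∈ S, u = p ∨ simpLt u p := by
  obtain ⟨p, hp, h1⟩ := Set.exists_max_image S skey (Set.toFinite _) h
  exact ⟨p, hp, fun u hu => simpLt_of_skey _ _ (h1 u hu)⟩

theorem init_mem {n : ℕ} {I : Set (Fin n × Fin n)} (hI : IsInit I) {p : Fin n × Fin n}
    (hp : p ∈ I) (hm : ∀ u ∈ I, u = p ∨ simpLt u p) (u : Fin n × Fin n) :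
    u ∈ I ↔ lev u < lev p ∨ (lev u = lev p ∧ (u.1 : ℕ) ≤ p.1) := by
  constructor
  · intro h
    rcases hm u h with rfl | h1
    · exact Or.inr ⟨rfl, le_rfl⟩
    · simp only [simpLt, lev] at *
      omega
  · intro h
    rcases simpLt_tri u p with h1 | h1 | h1
    · exact hI p hp u h1
    · rwa [h1]
    · exfalso
      simp only [simpLt, lev] at *
      omega

theorem level_count {n : ℕ} (A : Set (Fin n × Fin n)) (l lo hi : ℕ) (h : ∀ u ∈ A, lev u = l)
    (h2 : ∀ u ∈ A, lo ≤ (u.1 : ℕ) ∧ (u.1 : ℕ) ≤ hi) : A.ncard ≤ hi + 1 - lo := by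
  have : A.ncard ≤ (↑(Finset.Icc lo hi) : Set ℕ).ncard := by
    apply Set.ncard_le_ncard_of_injOn (fun u => (u.1 : ℕ))
    · intro u hu
      simpa using h2 u hu
    · intro u hu v hv huv
      have h3 := h u hu
      have h4 := h v hv
      simp only [lev] at *
      ext
      · exact huv
      · omega
  rwa [Set.ncard_coe_finset, Nat.card_Icc] at this

theorem init_border {n : ℕ} {I : Set (Fin n × Fin n)} (hI : IsInit I) {p : Fin n × Fin n}
    (hp : p ∈ I) (hm : ∀ u ∈ I, u = p ∨ simpLt u p) (v : Fin n × Fin n) 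
    (hv : v ∈ nodeBorder (gridGraph n) I) :
    (lev v = lev p ∧ (p.1 : ℕ) < v.1) ∨ (lev v = lev p + 1 ∧ (v.1 : ℕ) ≤ p.1 + 1) := by
  obtain ⟨h1, u, h2, h3⟩ := hv
  rw [init_mem hI hp hm] at h1 h2
  rw [gAdj] at h3
  simp only [lev] at *
  omega

theorem init_border_le {n : ℕ} {I : Set (Fin n × Fin n)} (hI : IsInit I) {p : Fin n × Fin n}
    (hp : p ∈ I) (hm : ∀ u ∈ I, u = p ∨ simpLt u p) :
    (nodeBorder (gridGraph n) I).ncard ≤ lev p + 2 ∧ 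
    (nodeBorder (gridGraph n) I).ncard ≤ 2 * n - 1 - lev p ∧
    (nodeBorder (gridGraph n) I).ncard ≤ n := by
  set B := nodeBorder (gridGraph n) I with hB
  have hb := init_border hI hp hm
  rw [← hB] at hb
  have hun : B.ncard ≤ {u ∈ B | lev u = lev p}.ncard + {u ∈ B | lev u = lev p + 1}.ncard := by
    refine le_trans (Set.ncard_le_ncard ?_ (Set.toFinite _)) (Set.ncard_union_le _ _)
    intro u hu
    rcases hb u hu with h | h
    · exact Or.inl ⟨hu, h.1⟩
    · exact Or.inr ⟨hu, h.1⟩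
  have hp1 := p.1.2
  have hp2 := p.2.2
  by_cases hr : lev p + 1 ≤ n - 1
  · have h1 := level_count {u ∈ B | lev u = lev p} (lev p) (p.1 + 1) (lev p) (fun u hu => hu.2)
      (by
        rintro u ⟨h1, h2⟩
        have := hb u h1
        simp only [lev] at *
        omega)
    have h2 := level_count {u ∈ B | lev u = lev p + 1} (lev p + 1) 0 (p.1 + 1) (fun u hu => hu.2)
      (by
        rintro u ⟨h1, h2⟩
        have := hb u h1
        simp only [lev] at *
        omega)
    simp only [lev] at *
    omega
  · have h1 := level_count {u ∈ B | lev u = lev p} (lev p) (p.1 + 1) (n - 1) (fun u hu => hu.2)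
      (by
        rintro u ⟨h1, h2⟩
        have := hb u h1
        have := u.1.2
        simp only [lev] at *
        omega)
    have h2 := level_count {u ∈ B | lev u = lev p + 1} (lev p + 1) (lev p + 2 - n) (p.1 + 1) (fun u hu => hu.2)
      (by
        rintro u ⟨h1, h2⟩
        have := hb u h1
        have := u.2.2
        simp only [lev] at *
        omega)
    simp only [lev] at *
    omega

theorem iso_ineq {n : ℕ} (I S : Set (Fin n × Fin n)) (hI : IsInit I) (hc : S.ncard = I.ncard) :
    (nodeBorder (gridGraph n) I).ncard ≤ (nodeBorder (gridGraph n) S).ncard := by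
  obtain ⟨T, hT, hTS, hTb⟩ := exists_down S
  refine le_trans ?_ hTb
  rw [← hTS] at hc
  rcases I.eq_empty_or_nonempty with rfl | hne
  · have : nodeBorder (gridGraph n) (∅ : Set (Fin n × Fin n)) = ∅ := by
      ext v; simp [nodeBorder]
    rw [this]; simp
  obtain ⟨p, hp, hm⟩ := exists_simp_max I hne
  obtain ⟨h1, h2, h3⟩ := init_border_le hI hp hm
  have hTne : T.Nonempty := by
    apply Set.nonempty_of_ncard_ne_zero
    rw [hc]
    exact Set.ncard_ne_zero_of_mem hp
  rcases down_cases T hT hTne with h | ⟨r, h, h'⟩ | ⟨r, h, hr, h'⟩ | h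
  · omega
  · have : lev p ≤ r := by
      by_contra hlt
      have hsub : T ⊆ I \ {p} := by
        intro u hu
        have := h u hu
        refine ⟨(init_mem hI hp hm u).2 (Or.inl (by omega)), ?_⟩
        rintro rfl
        omega
      have h4 := Set.ncard_le_ncard hsub (Set.toFinite _)
      have h5 := Set.ncard_sdiff_singleton_lt_of_mem hp (Set.toFinite _)
      omega
    omega
  · by_cases hpr : r ≤ lev p
    · omega
    · have hIT : I ⊆ T := by
        intro u hu
        by_contra hu2
        have := h u hu2
        have := (init_mem hI hp hm u).1 hu
        omega
      have hIeq : I = T := Set.eq_of_subset_of_ncard_le hIT hc.le (Set.toFinite _)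
      rw [hIeq]
  · have : I = Set.univ := by
      apply Set.eq_of_subset_of_ncard_le (Set.subset_univ _) _ (Set.toFinite _)
      rw [← h, hc]
    rw [this, h]

theorem init_cnb {n : ℕ} (I : Set (Fin n × Fin n)) (hI : IsInit I) : IsInit (cnb (gridGraph n) I) := by
  intro u hu v hvu
  by_cases hv : v ∈ I
  · exact Or.inl hv
  rcases hu with hu | hu
  · exact Or.inl (hI u hu v hvu)
  have hne : I.Nonempty := by
    obtain ⟨_, w, hw, _⟩ := hu
    exact ⟨w, hw⟩
  obtain ⟨p, hp, hm⟩ := exists_simp_max I hne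
  have hb := init_border hI hp hm u hu
  rw [mem_cnb]
  right
  rw [init_mem hI hp hm] at hv
  have h1 := p.1.2
  have h2 := p.2.2
  have h3 := v.1.2
  have h4 := v.2.2
  by_cases hl : lev v = lev p
  · refine ⟨(⟨v.1 - 1, by omega⟩, v.2), ?_, ?_⟩
    · rw [init_mem hI hp hm]
      simp only [lev] at *
      omega
    · rw [gAdj]
      refine Or.inr ⟨rfl, Or.inl ?_⟩
      simp only [lev] at *
      omega
  · have hl2 : lev v = lev p + 1 ∧ (v.1 : ℕ) ≤ p.1 + 1 := by
      simp only [lev, simpLt] at *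
      omega
    by_cases hv1 : (v.1 : ℕ) ≤ p.1
    · refine ⟨(v.1, ⟨v.2 - 1, by omega⟩), ?_, ?_⟩
      · rw [init_mem hI hp hm]
        simp only [lev] at *
        omega
      · rw [gAdj]
        refine Or.inl ⟨rfl, Or.inl ?_⟩
        simp only [lev] at *
        omega
    · refine ⟨p, hp, ?_⟩
      rw [gAdj]
      simp only [lev] at *
      omega

theorem phiV_init {n : ℕ} (I : Set (Fin n × Fin n)) (hI : IsInit I) :
    phiV (gridGraph n) I.ncard = (nodeBorder (gridGraph n) I).ncard := by
  apply le_antisymm (phiV_le _ _)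
  have hm : phiV (gridGraph n) I.ncard ∈ {b : ℕ | ∃ S' : Set (Fin n × Fin n), S'.ncard = I.ncard ∧
      b = (nodeBorder (gridGraph n) S').ncard} := Nat.sInf_mem ⟨_, I, rfl, rfl⟩
  obtain ⟨S, h1, h2⟩ := hm
  rw [h2]
  exact iso_ineq I S hI h1

theorem grid_connected {n : ℕ} (hn : 1 ≤ n) : (gridGraph n).Connected := by
  have key : ∀ m, ∀ u : Fin n × Fin n, lev u = m →
      (gridGraph n).Reachable u ((⟨0, hn⟩, ⟨0, hn⟩) : Fin n × Fin n) := by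
    intro m
    induction m with
    | zero =>
      intro u hu
      have : u = ((⟨0, hn⟩, ⟨0, hn⟩) : Fin n × Fin n) := by
        simp only [lev] at hu
        ext
        · change (u.1 : ℕ) = 0; omega
        · change (u.2 : ℕ) = 0; omega
      rw [this]
    | succ m ih =>
      intro u hu
      have h1 := u.1.2
      have h2 := u.2.2
      simp only [lev] at hu ih
      by_cases h : (u.1 : ℕ) = 0
      · have hr := ih (u.1, ⟨u.2 - 1, by omega⟩) (by simp only; omega)
        refine SimpleGraph.Reachable.trans (SimpleGraph.Adj.reachable ?_) hr
        rw [gAdj]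
        refine Or.inl ⟨rfl, Or.inr ?_⟩
        simp only; omega
      · have hr := ih (⟨u.1 - 1, by omega⟩, u.2) (by simp only; omega)
        refine SimpleGraph.Reachable.trans (SimpleGraph.Adj.reachable ?_) hr
        rw [gAdj]
        refine Or.inr ⟨rfl, Or.inr ?_⟩
        simp only; omega
  have : Nonempty (Fin n × Fin n) := ⟨(⟨0, hn⟩, ⟨0, hn⟩)⟩
  exact ⟨fun u v => (key _ u rfl).trans (key _ v rfl).symm⟩

/-- set cooled after round `i` -/
def coolB {V : Type*} (G : SimpleGraph V) (w : ℕ → V) (i : ℕ) : Set V :=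
  {u | ∃ j, j + 1 + G.dist (w j) u ≤ i}

theorem mem_cnb_coolB {V : Type*} {G : SimpleGraph V} (hG : G.Connected) (w : ℕ → V) (i : ℕ) (u : V) :
    u ∈ cnb G (coolB G w i) ↔ ∃ j, j < i ∧ j + 1 + G.dist (w j) u ≤ i + 1 := by
  rw [mem_cnb]
  constructor
  · rintro (⟨j, hj⟩ | ⟨u', ⟨j, hj⟩, h⟩)
    · exact ⟨j, by omega, by omega⟩
    · refine ⟨j, by omega, ?_⟩
      have h1 := hG.dist_triangle (u := w j) (v := u') (w := u)
      rw [SimpleGraph.dist_eq_one_iff_adj.2 h] at h1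
      omega
  · rintro ⟨j, hj, h⟩
    by_cases h1 : j + 1 + G.dist (w j) u ≤ i
    · exact Or.inl ⟨j, h1⟩
    · right
      obtain ⟨p, hp⟩ := hG.exists_walk_length_eq_dist u (w j)
      rw [SimpleGraph.dist_comm] at hp
      cases p with
      | nil => rw [SimpleGraph.dist_self] at h1; omega
      | @cons _ u' _ hadj q =>
        refine ⟨u', ⟨j, ?_⟩, hadj.symm⟩
        have h2 := SimpleGraph.dist_le q
        rw [SimpleGraph.dist_comm] at h2
        rw [SimpleGraph.Walk.length_cons] at hp
        omega

theorem coolB_succ {V : Type*} {G : SimpleGraph V} (hG : G.Connected) (w : ℕ → V) (i : ℕ) :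
    coolB G w (i + 1) = insert (w i) (cnb G (coolB G w i)) := by
  ext u
  rw [Set.mem_insert_iff, mem_cnb_coolB hG]
  constructor
  · rintro ⟨j, hj⟩
    by_cases h : j < i
    · exact Or.inr ⟨j, h, hj⟩
    · have h2 : j = i := by omega
      subst h2
      left
      have : G.dist (w j) u = 0 := by omega
      exact ((hG.dist_eq_zero_iff).1 this).symm
  · rintro (rfl | ⟨j, _, h⟩)
    · exact ⟨i, by simp⟩
    · exact ⟨j, h⟩

theorem coolB_zero {V : Type*} (G : SimpleGraph V) (w : ℕ → V) : coolB G w 0 = ∅ := by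
  ext u
  simp [coolB]

theorem coolTime_le_iff {V : Type*} [Fintype V] (G : SimpleGraph V) {k : ℕ} (v : Fin k → V)
    (hk : 0 < k) (t : ℕ) :
    coolTime G v ≤ t ↔ ∀ u, ∃ i : Fin k, (i : ℕ) + 1 + G.dist (v i) u ≤ t := by
  unfold coolTime
  rw [Finset.sup_le_iff]
  constructor
  · intro h u
    have h1 := h u (Finset.mem_univ _)
    have h2 : sInf {m : ℕ | ∃ i : Fin k, m = (i : ℕ) + 1 + G.dist (v i) u} ∈
      {m : ℕ | ∃ i : Fin k, m = (i : ℕ) + 1 + G.dist (v i) u} := Nat.sInf_mem ⟨_, ⟨0, hk⟩, rfl⟩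
    obtain ⟨i, hi⟩ := h2
    exact ⟨i, by omega⟩
  · intro h u _
    obtain ⟨i, hi⟩ := h u
    exact le_trans (Nat.sInf_le ⟨i, rfl⟩) hi

theorem xseq_ge (n i : ℕ) : i + 1 ≤ gridXseq n i := by
  induction i with
  | zero => simp [gridXseq]
  | succ i ih => rw [gridXseq]; omega

theorem xseq_inf_mem (n : ℕ) : n ^ 2 ≤ gridXseq n (sInf {i : ℕ | n ^ 2 ≤ gridXseq n i}) := by
  have h : sInf {i : ℕ | n ^ 2 ≤ gridXseq n i} ∈ {i : ℕ | n ^ 2 ≤ gridXseq n i} :=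
    Nat.sInf_mem ⟨n ^ 2, le_trans (Nat.le_succ _) (xseq_ge n (n ^ 2))⟩
  exact h

theorem ncard_univ_grid (n : ℕ) : (Set.univ : Set (Fin n × Fin n)).ncard = n ^ 2 := by
  rw [Set.ncard_univ]
  simp [sq]

theorem upper_bound {n : ℕ} (hn : 1 ≤ n) {k : ℕ} (v : Fin k → Fin n × Fin n)
    (hv : IsCoolingSeq (gridGraph n) v) :
    coolTime (gridGraph n) v ≤ sInf {i : ℕ | n ^ 2 ≤ gridXseq n i} + 1 := by
  have hG := grid_connected hn
  set I := sInf {i : ℕ | n ^ 2 ≤ gridXseq n i} with hI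
  let o : Fin n × Fin n := (⟨0, hn⟩, ⟨0, hn⟩)
  have hk : 0 < k := by
    obtain ⟨i, _⟩ := hv.2 o
    exact i.pos
  rw [coolTime_le_iff _ _ hk]
  by_cases hIk : I < k
  swap
  · intro u
    obtain ⟨i, hi⟩ := hv.2 u
    exact ⟨i, by omega⟩
  let w : ℕ → Fin n × Fin n := fun i => if h : i < k then v ⟨i, h⟩ else o
  have hw : ∀ i (h : i < k), w i = v ⟨i, h⟩ := fun i h => dif_pos h
  have grow : ∀ i, i < k → gridXseq n i ≤ (coolB (gridGraph n) w (i + 1)).ncard := by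
    intro i
    induction i with
    | zero =>
      intro _
      rw [coolB_succ hG]
      change 1 ≤ _
      rw [Nat.one_le_iff_ne_zero]
      exact Set.ncard_ne_zero_of_mem (Set.mem_insert _ _)
    | succ i ih =>
      intro hi
      have ih := ih (by omega)
      rw [coolB_succ hG w (i + 1), Set.ncard_insert_of_notMem, ncard_cnb]
      · rw [gridXseq]
        have h1 := phiV_mono (gridGraph n) _ ih
        have h2 := phiV_le (gridGraph n) (coolB (gridGraph n) w (i + 1))
        omega
      · rw [mem_cnb_coolB hG]
        rintro ⟨j, hj, h⟩
        have h3 := hv.1 ⟨j, by omega⟩ ⟨i + 1, hi⟩ (by simpa using hj)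
        rw [hw j (by omega), hw (i + 1) hi] at h
        simp only at h3
        omega
  have h1 := grow I hIk
  have h2 := xseq_inf_mem n
  rw [← hI] at h2
  have h3 : coolB (gridGraph n) w (I + 1) = Set.univ := by
    apply Set.eq_of_subset_of_ncard_le (Set.subset_univ _) _ (Set.toFinite _)
    rw [ncard_univ_grid]
    omega
  intro u
  have : u ∈ coolB (gridGraph n) w (I + 1) := by rw [h3]; trivial
  obtain ⟨j, hj⟩ := this
  refine ⟨⟨j, by omega⟩, ?_⟩
  rwa [hw j (by omega)] at hj

theorem exists_pick (n : ℕ) (hn : 1 ≤ n) (S : Set (Fin n × Fin n)) :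
    ∃ p, S ≠ Set.univ → p ∉ S ∧ ∀ u, u ∉ S → p = u ∨ simpLt p u := by
  by_cases h : S = Set.univ
  · exact ⟨(⟨0, hn⟩, ⟨0, hn⟩), fun h' => absurd h h'⟩
  · obtain ⟨p, hp, h1⟩ := exists_simp_min Sᶜ (Set.nonempty_compl.2 h)
    exact ⟨p, fun _ => ⟨hp, h1⟩⟩

/-- greedy sets -/
def grC {V : Type*} (G : SimpleGraph V) (pick : Set V → V) : ℕ → Set V
  | 0 => ∅
  | i + 1 => insert (pick (cnb G (grC G pick i))) (cnb G (grC G pick i))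

theorem greedy_exists {n : ℕ} (hn : 1 ≤ n) :
    ∃ (k : ℕ) (v : Fin k → Fin n × Fin n),
      IsCoolingSeq (gridGraph n) v ∧
      coolTime (gridGraph n) v = sInf {i : ℕ | n ^ 2 ≤ gridXseq n i} + 1 ∧
      ∀ (i : Fin k) (u : Fin n × Fin n),
        (¬ ∃ j : Fin k, (j : ℕ) < (i : ℕ) ∧
            (j : ℕ) + 1 + (gridGraph n).dist (v j) u ≤ (i : ℕ) + 1) →
        v i = u ∨ simpLt (v i) u := by
  classical
  have hG := grid_connected hn
  choose pick hpick using exists_pick n hn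
  let w : ℕ → Fin n × Fin n := fun i => pick (cnb (gridGraph n) (grC (gridGraph n) pick i))
  have hC : ∀ i, coolB (gridGraph n) w i = grC (gridGraph n) pick i := by
    intro i
    induction i with
    | zero => exact coolB_zero _ _
    | succ i ih => rw [coolB_succ hG, ih]; rfl
  have hw : ∀ i, w i = pick (cnb (gridGraph n) (coolB (gridGraph n) w i)) := by
    intro i; rw [hC]
  clear_value w
  clear hC
  set B := coolB (gridGraph n) w with hB
  have hBs : ∀ i, B (i + 1) = insert (w i) (cnb (gridGraph n) (B i)) := coolB_succ hG w
  have hcardle : ∀ S : Set (Fin n × Fin n), S.ncard ≤ n ^ 2 := by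
    intro S
    rw [← ncard_univ_grid]
    exact Set.ncard_le_ncard (Set.subset_univ _) (Set.toFinite _)
  have hex : ∃ i, cnb (gridGraph n) (B i) = Set.univ := by
    by_contra hne
    push Not at hne
    have : ∀ i, i ≤ (B i).ncard := by
      intro i
      induction i with
      | zero => exact Nat.zero_le _
      | succ i ih =>
        rw [hBs, Set.ncard_insert_of_notMem, ncard_cnb]
        · omega
        · rw [hw]; exact (hpick _ (hne i)).1
    have h1 := this (n ^ 2 + 1)
    have h2 := hcardle (B (n ^ 2 + 1))
    omega
  let k := Nat.find hex
  have hk1 : cnb (gridGraph n) (B k) = Set.univ := Nat.find_spec hex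
  have hk2 : ∀ i, i < k → cnb (gridGraph n) (B i) ≠ Set.univ := fun i hi => Nat.find_min hex hi
  clear_value k
  let o : Fin n × Fin n := (⟨0, hn⟩, ⟨0, hn⟩)
  have hkpos : 0 < k := by
    rcases Nat.eq_zero_or_pos k with h | h
    · exfalso
      rw [h] at hk1
      have h1 : o ∈ cnb (gridGraph n) (B 0) := by rw [hk1]; trivial
      rw [mem_cnb_coolB hG] at h1
      obtain ⟨j, hj, _⟩ := h1
      omega
    · exact h
  have hnot : ∀ i, i < k → w i ∉ cnb (gridGraph n) (B i) := by
    intro i hi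
    have := (hpick _ (hk2 i hi)).1
    rwa [← hw] at this
  have hmin : ∀ i, i < k → ∀ u, u ∉ cnb (gridGraph n) (B i) → w i = u ∨ simpLt (w i) u := by
    intro i hi
    have := (hpick _ (hk2 i hi)).2
    rwa [← hw] at this
  have hinit : ∀ i, i ≤ k → IsInit (B i) := by
    intro i
    induction i with
    | zero =>
      intro _ u hu
      rw [hB, coolB_zero] at hu
      exact absurd hu (Set.notMem_empty u)
    | succ i ih =>
      intro hi
      have h1 := init_cnb _ (ih (by omega))
      rw [hBs]
      intro u hu v hvu
      by_cases hv : v ∈ cnb (gridGraph n) (B i)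
      · exact Or.inr hv
      rcases hu with rfl | hu
      · rcases hmin i (by omega) v hv with h | h
        · exact Or.inl h.symm
        · exfalso
          simp only [simpLt] at h hvu
          omega
      · exact Or.inr (h1 u hu v hvu)
  have hphi : ∀ i, i ≤ k → (cnb (gridGraph n) (B i)).ncard = (B i).ncard + phiV (gridGraph n) (B i).ncard := by
    intro i hi
    rw [ncard_cnb, phiV_init _ (hinit i hi)]
  have hcard : ∀ i, i < k → (B (i + 1)).ncard = gridXseq n i := by
    intro i
    induction i with
    | zero =>
      intro hi
      rw [hBs, Set.ncard_insert_of_notMem (hnot 0 hi), ncard_cnb, hB, coolB_zero]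
      have : nodeBorder (gridGraph n) (∅ : Set (Fin n × Fin n)) = ∅ := by
        ext v; simp [nodeBorder]
      rw [this]; simp [gridXseq]
    | succ i ih =>
      intro hi
      rw [hBs, Set.ncard_insert_of_notMem (hnot (i + 1) hi), hphi _ hi.le, ih (by omega), gridXseq]
  have hcool : IsCoolingSeq (gridGraph n) (fun i : Fin k => w i) := by
    constructor
    · intro i j hij
      by_contra hle
      simp only at hle
      apply hnot j j.2
      rw [mem_cnb_coolB hG]
      have hij' : (i : ℕ) < j := hij
      exact ⟨i, hij', by omega⟩
    · intro u
      have h1 : u ∈ cnb (gridGraph n) (B k) := by rw [hk1]; trivial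
      rw [mem_cnb_coolB hG] at h1
      obtain ⟨j, hj, h⟩ := h1
      exact ⟨⟨j, hj⟩, h⟩
  refine ⟨k, fun i => w i, hcool, ?_, ?_⟩
  · apply le_antisymm (upper_bound hn _ hcool)
    by_contra hlt
    have hle : coolTime (gridGraph n) (fun i : Fin k => w i) ≤ sInf {i : ℕ | n ^ 2 ≤ gridXseq n i} := by
      omega
    rw [coolTime_le_iff _ _ hkpos] at hle
    have hmem : ∀ i, n ^ 2 ≤ gridXseq n i → sInf {i : ℕ | n ^ 2 ≤ gridXseq n i} ≤ i :=
      fun i hi => Nat.sInf_le hi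
    generalize sInf {i : ℕ | n ^ 2 ≤ gridXseq n i} = I at hle hmem
    cases I with
    | zero =>
      obtain ⟨i, hi⟩ := hle o
      omega
    | succ m =>
      have huniv : B (m + 1) = Set.univ := by
        apply Set.eq_univ_of_forall
        intro u
        obtain ⟨i, hi⟩ := hle u
        exact ⟨i, hi⟩
      by_cases hm : m < k
      · have h1 := hcard m hm
        rw [huniv, ncard_univ_grid] at h1
        have := hmem m h1.le
        omega
      · obtain ⟨k', rfl⟩ : ∃ k', k = k' + 1 := ⟨k - 1, by omega⟩
        have h1 := hphi (k' + 1) le_rfl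
        rw [hk1, ncard_univ_grid, hcard k' (by omega)] at h1
        have := hmem (k' + 1) (by rw [gridXseq]; omega)
        omega
  · intro i u hu
    apply hmin i i.2 u
    rw [mem_cnb_coolB hG]
    rintro ⟨j, hj, h⟩
    exact hu ⟨⟨j, by omega⟩, hj, h⟩

/-- With `I` the smallest (1-based) index such that `x_I ≥ n²`, the cooling number of the
`n × n` grid equals `I`, and this value is achieved by the greedy strategy choosing, in
each round, the simplicially smallest vertex that is not yet cooled as the next source. -/
theorem coolingNumber_gridGraph_greedy (n : ℕ) (hn : 1 ≤ n) :
    coolingNumber (gridGraph n) = sInf {i : ℕ | n ^ 2 ≤ gridXseq n i} + 1 ∧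
    ∃ (k : ℕ) (v : Fin k → Fin n × Fin n),
      IsCoolingSeq (gridGraph n) v ∧
      coolTime (gridGraph n) v = sInf {i : ℕ | n ^ 2 ≤ gridXseq n i} + 1 ∧
      ∀ (i : Fin k) (u : Fin n × Fin n),
        (¬ ∃ j : Fin k, (j : ℕ) < (i : ℕ) ∧
            (j : ℕ) + 1 + (gridGraph n).dist (v j) u ≤ (i : ℕ) + 1) →
        v i = u ∨ simpLt (v i) u := by
  refine ⟨?_, greedy_exists hn⟩
  apply IsGreatest.csSup_eq
  constructor
  · obtain ⟨k, v, h1, h2, _⟩ := greedy_exists hn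
    exact ⟨k, v, h1, h2.symm⟩
  · rintro T ⟨k, v, h1, rfl⟩
    exact upper_bound hn v h1
end

section
/- For every finite connected simple graph G, the cooling number satisfies CL(ILT(G)) ≥ CL(G). -/
/-- The Iterated Local Transitivity graph of `G`, on vertex set `V ⊕ V`, where `Sum.inr x`
is the clone of the original vertex `Sum.inl x`: clones are adjacent to their original
vertex and to its neighbors, and clones are pairwise non-adjacent. -/
def ILT {V : Type*} (G : SimpleGraph V) : SimpleGraph (V ⊕ V) :=
  SimpleGraph.fromRel fun a b =>
    match a, b with
    | Sum.inl x, Sum.inl y => G.Adj x y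
    | Sum.inl x, Sum.inr y => x = y ∨ G.Adj x y
    | Sum.inr x, Sum.inl y => x = y ∨ G.Adj x y
    | Sum.inr _, Sum.inr _ => False

/-- The vertex type of `ILT_t(G)`. -/
def ILTVert (V : Type*) : ℕ → Type _
  | 0 => V
  | t + 1 => ILTVert V t ⊕ ILTVert V t

instance ILTVert.fintype (V : Type*) [Fintype V] : ∀ t, Fintype (ILTVert V t)
  | 0 => inferInstanceAs (Fintype V)
  | t + 1 =>
    letI := ILTVert.fintype V t
    inferInstanceAs (Fintype (ILTVert V t ⊕ ILTVert V t))

/-- `ILTiter G t` is the result of `t` iterated applications of the ILT construction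
to `G`. -/
def ILTiter {V : Type*} (G : SimpleGraph V) : (t : ℕ) → SimpleGraph (ILTVert V t)
  | 0 => G
  | t + 1 => ILT (ILTiter G t)

theorem ILT_adj_ll {V : Type*} {G : SimpleGraph V} {x y : V} (h : G.Adj x y) :
    (ILT G).Adj (Sum.inl x) (Sum.inl y) := by
  rw [ILT, SimpleGraph.fromRel_adj]
  exact ⟨fun e => h.ne (Sum.inl.inj e), Or.inl h⟩

theorem ILT_adj_lr {V : Type*} {G : SimpleGraph V} {x y : V} (h : x = y ∨ G.Adj x y) :
    (ILT G).Adj (Sum.inl x) (Sum.inr y) := by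
  rw [ILT, SimpleGraph.fromRel_adj]
  exact ⟨Sum.inl_ne_inr, Or.inl h⟩

theorem ILT_adj_proj {V : Type*} {G : SimpleGraph V} {a b : V ⊕ V} (h : (ILT G).Adj a b) :
    Sum.elim id id a = Sum.elim id id b ∨ G.Adj (Sum.elim id id a) (Sum.elim id id b) := by
  rw [ILT, SimpleGraph.fromRel_adj] at h
  rcases a with a | a <;> rcases b with b | b <;> simp_all [SimpleGraph.adj_comm, eq_comm]

theorem ILT_walk_ll {V : Type*} {G : SimpleGraph V} {x y : V} (p : G.Walk x y) :
    ∃ q : (ILT G).Walk (Sum.inl x) (Sum.inl y), q.length = p.length := by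
  induction p with
  | nil => exact ⟨SimpleGraph.Walk.nil, rfl⟩
  | cons h p ih =>
    obtain ⟨q, hq⟩ := ih
    exact ⟨SimpleGraph.Walk.cons (ILT_adj_ll h) q, by simp [hq]⟩

theorem ILT_walk_lr {V : Type*} {G : SimpleGraph V} {x y : V} (p : G.Walk x y) :
    ∃ q : (ILT G).Walk (Sum.inl x) (Sum.inr y), q.length ≤ max 1 p.length := by
  induction p with
  | nil => exact ⟨SimpleGraph.Walk.cons (ILT_adj_lr (Or.inl rfl)) SimpleGraph.Walk.nil, by simp⟩
  | @cons u z y h p ih =>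
    by_cases hz : z = y
    · subst hz
      exact ⟨SimpleGraph.Walk.cons (ILT_adj_lr (Or.inr h)) SimpleGraph.Walk.nil, by simp⟩
    · obtain ⟨q, hq⟩ := ih
      have : p.length ≠ 0 := fun e => hz (SimpleGraph.Walk.eq_of_length_eq_zero e)
      refine ⟨SimpleGraph.Walk.cons (ILT_adj_ll h) q, ?_⟩
      simp only [SimpleGraph.Walk.length_cons]
      omega

theorem ILT_walk_proj {V : Type*} {G : SimpleGraph V} (hG : G.Connected) {a b : V ⊕ V}
    (p : (ILT G).Walk a b) : G.dist (Sum.elim id id a) (Sum.elim id id b) ≤ p.length := by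
  induction p with
  | nil => simp
  | @cons a c b h p ih =>
    simp only [SimpleGraph.Walk.length_cons]
    rcases ILT_adj_proj h with e | e
    · rw [e]; omega
    · have h1 := hG.dist_triangle (u := Sum.elim id id a) (v := Sum.elim id id c)
        (w := Sum.elim id id b)
      have h2 := SimpleGraph.dist_eq_one_iff_adj.mpr e
      omega

theorem ILT_dist_ll {V : Type*} {G : SimpleGraph V} (hG : G.Connected) (x y : V) :
    (ILT G).dist (Sum.inl x) (Sum.inl y) = G.dist x y := by
  obtain ⟨p, hp⟩ := hG.exists_walk_length_eq_dist x y
  obtain ⟨q, hq⟩ := ILT_walk_ll p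
  apply le_antisymm
  · rw [← hp, ← hq]; exact SimpleGraph.dist_le q
  · obtain ⟨r, hr⟩ := q.reachable.exists_walk_length_eq_dist
    rw [← hr]; exact ILT_walk_proj hG r

theorem ILT_dist_lr {V : Type*} {G : SimpleGraph V} (hG : G.Connected) (x y : V) :
    (ILT G).dist (Sum.inl x) (Sum.inr y) ≤ max 1 (G.dist x y) := by
  obtain ⟨p, hp⟩ := hG.exists_walk_length_eq_dist x y
  obtain ⟨q, hq⟩ := ILT_walk_lr p
  rw [← hp]; exact (SimpleGraph.dist_le q).trans hq

theorem coolTimes_bddAbove {V : Type*} [Fintype V] (G : SimpleGraph V) :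
    BddAbove {T : ℕ | ∃ (k : ℕ) (v : Fin k → V), IsCoolingSeq G v ∧ T = coolTime G v} := by
  refine ⟨Fintype.card V + 1, ?_⟩
  rintro T ⟨k, v, hv, rfl⟩
  have key : ∀ i j : Fin k, i < j → v i ≠ v j := fun i j hij e => by
    have := hv.1 i j hij
    rw [e, SimpleGraph.dist_self] at this
    omega
  have hinj : Function.Injective v := fun i j e => by
    rcases lt_trichotomy i j with h | h | h
    · exact absurd e (key i j h)
    · exact h
    · exact absurd e.symm (key j i h)
  have hk := Fintype.card_le_of_injective v hinj
  rw [Fintype.card_fin] at hk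
  refine Finset.sup_le fun u _ => ?_
  obtain ⟨i, hi⟩ := hv.2 u
  have hm : (i : ℕ) + 1 + G.dist (v i) u ∈
      {m : ℕ | ∃ i : Fin k, m = (i : ℕ) + 1 + G.dist (v i) u} := ⟨i, rfl⟩
  have h2 := Nat.sInf_le hm
  exact h2.trans (by omega)

/-- For every finite connected simple graph `G`, `CL(ILT(G)) ≥ CL(G)`. -/
theorem coolingNumber_le_ILT {V : Type*} [Fintype V] (G : SimpleGraph V)
    (hG : G.Connected) :
    coolingNumber G ≤ coolingNumber (ILT G) := by
  apply csSup_le'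
  rintro T ⟨k, v, hv, rfl⟩
  have hc : IsCoolingSeq (ILT G) (fun i => (Sum.inl (v i) : V ⊕ V)) := by
    refine ⟨fun i j hij => ?_, ?_⟩
    · rw [ILT_dist_ll hG]; exact hv.1 i j hij
    · rintro (u | u)
      · obtain ⟨i, hi⟩ := hv.2 u
        exact ⟨i, by rw [ILT_dist_ll hG]; exact hi⟩
      · obtain ⟨i, hi⟩ := hv.2 u
        have := ILT_dist_lr hG (v i) u
        have := i.2
        exact ⟨i, by beta_reduce; omega⟩
  refine le_trans ?_ (le_csSup (coolTimes_bddAbove (ILT G)) ⟨k, _, hc, rfl⟩)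
  refine Finset.sup_le fun u _ => ?_
  refine le_trans (le_of_eq ?_) (Finset.le_sup (Finset.mem_univ (Sum.inl u : V ⊕ V)))
  simp only [ILT_dist_ll hG]
end
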